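/- Let R be a commutative Noetherian ring, I an ideal, N a finitely generated R-module, and A an Artinian R-module. Fix i ≥ 0 and assume Ext_R^i(N/I^n N, A) has finite length for all sufficiently large n. Then there exists a polynomial p with rational coefficients such that λ(Ext_R^i(N/I^n N, A)) = p(n) for all sufficiently large n. -/

import Mathlib

set_option synthInstance.maxHeartbeats 1000000

open CategoryTheory

universe u

/-- The length `λ(M)` of a module `M`, realized as the Krull dimension of the lattice of
submodules of `M`. -/
noncomputable def moduleLength (R M : Type*) [Ring R] [AddCommGroup M] [Module R M] :
    WithBot ℕ∞ :=
  Order.krullDim (Submodule R M)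

/-- `Ext_R^i(A, B)`, as an `R`-module. -/
noncomputable abbrev extModule (R : Type u) [CommRing R] (i : ℕ) (A B : Type u)
    [AddCommGroup A] [Module R A] [AddCommGroup B] [Module R B] : Type u :=
  ↥(((Ext R (ModuleCat.{u} R) i).obj (Opposite.op (ModuleCat.of R A))).obj (ModuleCat.of R B))

/-- If monotone maps `D k` to a well-founded order are decreasing in `k` and jointly detect strict
inequalities, the source is well-founded. -/
lemma wellFoundedLT_of_antitone_detecting {α β : Type*} [PartialOrder α] [PartialOrder β]
    [WellFoundedLT β] (D : ℕ → α → β) (hD : ∀ k, Monotone (D k))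
    (hanti : ∀ k a, D (k + 1) a ≤ D k a)
    (h : ∀ a b, a ≤ b → (∀ k, D k a = D k b) → a = b) : WellFoundedLT α := by
  have hant (a : α) : Antitone fun k ↦ D k a := antitone_nat_of_succ_le fun k ↦ hanti k a
  have key : WellFoundedGT αᵒᵈ := by
    refine wellFoundedGT_iff_monotone_chain_condition.2 fun u ↦ ?_
    have hu {m n : ℕ} (hmn : m ≤ n) : OrderDual.ofDual (u n) ≤ OrderDual.ofDual (u m) :=
      u.monotone hmn
    have hDu (k : ℕ) : Antitone fun n ↦ D k (OrderDual.ofDual (u n)) :=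
      fun m n hmn ↦ hD k (hu hmn)
    obtain ⟨d, hd⟩ := WellFoundedLT.antitone_chain_condition
      (f := fun k ↦ D k (OrderDual.ofDual (u k)))
      fun m n hmn ↦ (hDu n hmn).trans (hant _ hmn)
    choose g hg using fun k ↦ WellFoundedLT.antitone_chain_condition (hDu k)
    refine ⟨d + ∑ k ∈ Finset.range d, g k, fun m hm ↦ ?_⟩
    refine OrderDual.ofDual.injective (h _ _ (hu hm) fun k ↦ ?_).symm
    rcases lt_or_ge k d with hk | hk
    · have hgk : g k ≤ d + ∑ k ∈ Finset.range d, g k :=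
        (Finset.single_le_sum (f := g) (fun _ _ ↦ Nat.zero_le _)
          (Finset.mem_range.2 hk)).trans (Nat.le_add_left _ _)
      exact (hg k m (hgk.trans hm)).symm.trans (hg k _ hgk)
    · have stable (n : ℕ) (hn : d ≤ n) :
          D k (OrderDual.ofDual (u n)) = D d (OrderDual.ofDual (u d)) := by
        apply le_antisymm
        · exact (hant _ hk).trans (hDu d hn)
        · refine (hd (max k n) (hk.trans (le_max_left _ _))).le.trans ?_
          exact (hDu (max k n) (le_max_right _ _)).trans (hant _ (le_max_left _ _))
      exact (stable m ((Nat.le_add_right _ _).trans hm)).trans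
        (stable _ (Nat.le_add_right _ _)).symm
  exact ⟨key.wf⟩

section GradedSystems

variable {R ι : Type*} [Ring R]

section Lowering

variable {E F G : ℕ → Type*}
  [∀ n, AddCommGroup (E n)] [∀ n, Module R (E n)]
  [∀ n, AddCommGroup (F n)] [∀ n, Module R (F n)]
  [∀ n, AddCommGroup (G n)] [∀ n, Module R (G n)]

/-- Graded submodules of a sequence of modules with operators `y j` of degree `-1`, `j ∈ s`. -/
abbrev LoweringSubmodule (y : ι → ∀ n, E (n + 1) →ₗ[R] E n) (s : Finset ι) :=
  {U : ∀ n, Submodule R (E n) // ∀ j ∈ s, ∀ n, U (n + 1) ≤ (U n).comap (y j n)}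

/-- The descending chain condition on graded submodules for operators of degree `-1`. -/
def IsLoweringArtinian (y : ι → ∀ n, E (n + 1) →ₗ[R] E n) (s : Finset ι) : Prop :=
  WellFoundedLT (LoweringSubmodule y s)

lemma IsLoweringArtinian.of_exact {s : Finset ι}
    {yE : ι → ∀ n, E (n + 1) →ₗ[R] E n} {yF : ι → ∀ n, F (n + 1) →ₗ[R] F n}
    {yG : ι → ∀ n, G (n + 1) →ₗ[R] G n}
    (hE : IsLoweringArtinian yE s) (hG : IsLoweringArtinian yG s)
    (f : ∀ n, E n →ₗ[R] F n) (g : ∀ n, F n →ₗ[R] G n)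
    (hf : ∀ j ∈ s, ∀ n x, f n (yE j n x) = yF j n (f (n + 1) x))
    (hg : ∀ j ∈ s, ∀ n x, g n (yF j n x) = yG j n (g (n + 1) x))
    (H : ∀ n x, g n x = 0 → ∃ z, f n z = x) : IsLoweringArtinian yF s := by
  unfold IsLoweringArtinian at *
  let φ : LoweringSubmodule yF s → LoweringSubmodule yE s × LoweringSubmodule yG s := fun U ↦
    (⟨fun n ↦ (U.1 n).comap (f n), fun j hj n x hx ↦ by
        simpa only [Submodule.mem_comap, hf j hj] using U.2 j hj n hx⟩,
     ⟨fun n ↦ (U.1 n).map (g n), fun j hj n ↦ by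
        rintro _ ⟨x, hx, rfl⟩
        exact ⟨yF j n x, U.2 j hj n hx, hg j hj n x⟩⟩)
  have hφ : Monotone φ := fun U V hUV ↦
    ⟨fun n ↦ Submodule.comap_mono (hUV n), fun n ↦ Submodule.map_mono (hUV n)⟩
  refine StrictMono.wellFoundedLT (f := φ) fun U V hUV ↦
    lt_of_le_not_ge (hφ hUV.le) fun hVU ↦ hUV.not_ge fun n v hv ↦ ?_
  obtain ⟨u, hu, huv⟩ := hVU.2 n ⟨v, hv, rfl⟩
  obtain ⟨z, hz⟩ := H n (v - u) (by rw [map_sub, huv, sub_self])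
  have hz' : z ∈ (U.1 n).comap (f n) := hVU.1 n (by
    change f n z ∈ V.1 n
    rw [hz]
    exact sub_mem hv (hUV.le n hu))
  have : v - u ∈ U.1 n := hz ▸ hz'
  simpa using add_mem this hu

/-- A sequence of modules with degree `-1` operators is Artinian once the kernel of one of the
commuting operators is Artinian with respect to the remaining ones. -/
lemma IsLoweringArtinian.insert_of_ker [DecidableEq ι] {s : Finset ι} {a : ι}
    {yE : ι → ∀ n, E (n + 1) →ₗ[R] E n} {yK : ι → ∀ n, F (n + 1) →ₗ[R] F n}
    (hcomm : ∀ j k n x, yE j n (yE k (n + 1) x) = yE k n (yE j (n + 1) x))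
    (hK : IsLoweringArtinian yK s) (hE : IsArtinian R (E 0))
    (f : ∀ n, F n →ₗ[R] E (n + 1))
    (hf : ∀ j ∈ s, ∀ n x, f n (yK j n x) = yE j (n + 1) (f (n + 1) x))
    (H : ∀ n x, yE a n x = 0 → ∃ z, f n z = x) : IsLoweringArtinian yE (insert a s) := by
  unfold IsLoweringArtinian at *
  let T : LoweringSubmodule yE (insert a s) → LoweringSubmodule yE (insert a s) := fun U ↦
    ⟨fun n ↦ (U.1 (n + 1)).map (yE a n), fun j hj n ↦ by
      rintro _ ⟨x, hx, rfl⟩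
      exact ⟨yE j (n + 1) x, U.2 j hj _ hx, hcomm _ _ _ _⟩⟩
  have hT : Monotone T := fun U V hUV n ↦ Submodule.map_mono (hUV (n + 1))
  have hTle (U) : T U ≤ U := fun n ↦ by
    rintro _ ⟨x, hx, rfl⟩
    exact U.2 a (Finset.mem_insert_self _ _) n hx
  let δ : LoweringSubmodule yE (insert a s) → Submodule R (E 0) × LoweringSubmodule yK s :=
    fun U ↦ (U.1 0, ⟨fun n ↦ (U.1 (n + 1)).comap (f n), fun j hj n x hx ↦ by
      simpa only [Submodule.mem_comap, hf j hj] using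
        U.2 j (Finset.mem_insert_of_mem hj) (n + 1) hx⟩)
  have hδ : Monotone δ := fun U V hUV ↦ ⟨hUV 0, fun n ↦ Submodule.comap_mono (hUV (n + 1))⟩
  refine wellFoundedLT_of_antitone_detecting (fun k U ↦ δ (T^[k] U))
    (fun k ↦ hδ.comp (hT.iterate k)) (fun k U ↦ ?_) fun U V hUV h ↦ ?_
  · rw [Function.iterate_succ_apply']
    exact hδ (hTle _)
  · refine le_antisymm hUV fun n ↦ ?_
    suffices ∀ n k, (T^[k] V).1 n ≤ (T^[k] U).1 n from this n 0
    intro n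
    induction n with
    | zero => exact fun k ↦ (congrArg Prod.fst (h k)).ge
    | succ n ih =>
      intro k v hv
      have hle : T^[k] U ≤ T^[k] V := hT.iterate k hUV
      have hv' : yE a n v ∈ (T^[k + 1] V).1 n := by
        rw [Function.iterate_succ_apply']
        exact ⟨v, hv, rfl⟩
      have hu' := ih (k + 1) hv'
      rw [Function.iterate_succ_apply'] at hu'
      obtain ⟨u, hu, huv⟩ := hu'
      obtain ⟨z, hz⟩ := H n (v - u) (by rw [map_sub, huv, sub_self])
      have hz' : z ∈ (δ (T^[k] V)).2.1 n := by
        change f n z ∈ (T^[k] V).1 (n + 1)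
        rw [hz]
        exact sub_mem hv (hle _ hu)
      rw [← h k] at hz'
      have : v - u ∈ (T^[k] U).1 (n + 1) := hz ▸ hz'
      simpa using add_mem this hu

lemma IsLoweringArtinian.of_eventually_subsingleton (y : ι → ∀ n, E (n + 1) →ₗ[R] E n)
    (s : Finset ι) (hE : ∀ n, IsArtinian R (E n)) (n₀ : ℕ)
    (h : ∀ n, n₀ ≤ n → Subsingleton (E n)) : IsLoweringArtinian y s := by
  unfold IsLoweringArtinian
  refine StrictMono.wellFoundedLT
    (f := fun (U : LoweringSubmodule y s) (i : Fin n₀) ↦ U.1 i) fun U V hUV ↦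
    lt_of_le_not_ge (fun i ↦ hUV.le i) fun hVU ↦ hUV.not_ge fun n ↦ ?_
  rcases lt_or_ge n n₀ with hn | hn
  · exact hVU ⟨n, hn⟩
  · have := h n hn
    exact (Subsingleton.elim _ _).le

lemma IsLoweringArtinian.eventually_subsingleton (y : ι → ∀ n, E (n + 1) →ₗ[R] E n)
    (h : IsLoweringArtinian y ∅) : ∃ n₀, ∀ n, n₀ ≤ n → Subsingleton (E n) := by
  unfold IsLoweringArtinian at h
  let u : ℕ → LoweringSubmodule y ∅ := fun k ↦
    ⟨fun n ↦ if k ≤ n then ⊤ else ⊥, fun _ hj ↦ absurd hj (Finset.notMem_empty _)⟩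
  have hu : Antitone u := by
    intro k l hkl n
    dsimp only [u]
    split_ifs with h₁ h₂
    · exact le_rfl
    · omega
    · exact bot_le
    · exact bot_le
  obtain ⟨n₀, hn₀⟩ := WellFoundedLT.antitone_chain_condition hu
  refine ⟨n₀, fun n hn ↦ ?_⟩
  have := congrFun (congrArg Subtype.val (hn₀ (n + 1) (by omega))) n
  simp only [u, hn, if_true, Nat.not_succ_le_self, if_false] at this
  exact (Submodule.subsingleton_iff R).1
    (subsingleton_of_top_le_bot (α := Submodule R (E n)) this.le)

lemma IsLoweringArtinian.shift {y : ι → ∀ n, E (n + 1) →ₗ[R] E n} {s : Finset ι}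
    (h : IsLoweringArtinian y s) :
    IsLoweringArtinian (E := fun n ↦ E (n + 1)) (fun j n ↦ y j (n + 1)) s := by
  unfold IsLoweringArtinian at *
  let φ : LoweringSubmodule (E := fun n ↦ E (n + 1)) (fun j n ↦ y j (n + 1)) s →
      LoweringSubmodule y s := fun U ↦
    ⟨fun | 0 => ⊤ | n + 1 => U.1 n, fun j hj n ↦ match n with
      | 0 => le_top
      | n + 1 => U.2 j hj n⟩
  refine StrictMono.wellFoundedLT (f := φ) fun U V hUV ↦
    lt_of_le_not_ge (fun n ↦ ?_) fun hVU ↦ hUV.not_ge fun n ↦ hVU (n + 1)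
  cases n with
  | zero => exact le_rfl
  | succ n => exact hUV.le n

lemma IsLoweringArtinian.of_insert_of_eq_zero [DecidableEq ι]
    {y : ι → ∀ n, E (n + 1) →ₗ[R] E n} {s : Finset ι} {a : ι}
    (h : IsLoweringArtinian y (insert a s)) (ha : ∀ n x, y a n x = 0) :
    IsLoweringArtinian y s := by
  unfold IsLoweringArtinian at *
  let φ : LoweringSubmodule y s → LoweringSubmodule y (insert a s) := fun U ↦
    ⟨U.1, fun j hj n x hx ↦ by
      obtain rfl | hj := Finset.mem_insert.1 hj
      · simp [ha]
      · exact U.2 j hj n hx⟩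
  exact StrictMono.wellFoundedLT (f := φ) fun U V hUV ↦ hUV

lemma isLoweringArtinian_of_subsingleton [∀ n, Subsingleton (E n)]
    (y : ι → ∀ n, E (n + 1) →ₗ[R] E n) (s : Finset ι) : IsLoweringArtinian y s :=
  .of_eventually_subsingleton y s (fun _ ↦ inferInstance) 0 fun _ _ ↦ inferInstance

/-- The operators induced on the kernels of the operator `y a`. -/
def loweringKer (y : ι → ∀ n, E (n + 1) →ₗ[R] E n)
    (hcomm : ∀ j k n x, y j n (y k (n + 1) x) = y k n (y j (n + 1) x)) (a j : ι) (n : ℕ) :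
    LinearMap.ker (y a (n + 1)) →ₗ[R] LinearMap.ker (y a n) :=
  (y j (n + 1)).restrict fun x hx ↦ by
    rw [LinearMap.mem_ker] at hx ⊢
    rw [hcomm, hx, map_zero]

/-- The operators induced on the cokernels of the operator `y a`. -/
def loweringCoker (y : ι → ∀ n, E (n + 1) →ₗ[R] E n)
    (hcomm : ∀ j k n x, y j n (y k (n + 1) x) = y k n (y j (n + 1) x)) (a j : ι) (n : ℕ) :
    (E (n + 1) ⧸ LinearMap.range (y a (n + 1))) →ₗ[R] E n ⧸ LinearMap.range (y a n) :=
  Submodule.mapQ _ _ (y j n) fun x hx ↦ by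
    obtain ⟨z, rfl⟩ := hx
    exact ⟨y j (n + 1) z, hcomm _ _ _ _⟩

lemma IsLoweringArtinian.ker [DecidableEq ι]
    {y : ι → ∀ n, E (n + 1) →ₗ[R] E n} {s : Finset ι} {a : ι}
    (h : IsLoweringArtinian y (insert a s))
    (hcomm : ∀ j k n x, y j n (y k (n + 1) x) = y k n (y j (n + 1) x)) :
    IsLoweringArtinian (E := fun n ↦ LinearMap.ker (y a n)) (loweringKer y hcomm a) s := by
  refine .of_insert_of_eq_zero (a := a) ?_ fun n x ↦ Subtype.ext x.2
  refine .of_exact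
    (isLoweringArtinian_of_subsingleton (R := R) (E := fun _ ↦ PUnit.{1}) (fun _ _ ↦ 0) _) h.shift
    (fun _ ↦ 0) (fun n ↦ (LinearMap.ker (y a n)).subtype) (fun _ _ _ _ ↦ by simp)
    (fun _ _ _ _ ↦ rfl) fun n x hx ↦ ⟨0, ?_⟩
  exact (Subtype.ext hx).symm

lemma IsLoweringArtinian.coker [DecidableEq ι]
    {y : ι → ∀ n, E (n + 1) →ₗ[R] E n} {s : Finset ι} {a : ι}
    (h : IsLoweringArtinian y (insert a s))
    (hcomm : ∀ j k n x, y j n (y k (n + 1) x) = y k n (y j (n + 1) x)) :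
    IsLoweringArtinian (E := fun n ↦ E n ⧸ LinearMap.range (y a n))
      (loweringCoker y hcomm a) s := by
  refine .of_insert_of_eq_zero (a := a) ?_ fun n x ↦ ?_
  · exact .of_exact h
      (isLoweringArtinian_of_subsingleton (R := R) (E := fun _ ↦ PUnit.{1}) (fun _ _ ↦ 0) _)
      (fun n ↦ (LinearMap.range (y a n)).mkQ) (fun _ ↦ 0)
      (fun _ _ _ _ ↦ rfl) (fun _ _ _ _ ↦ by simp) fun n x _ ↦ Submodule.mkQ_surjective _ x
  · obtain ⟨x, rfl⟩ := Submodule.mkQ_surjective _ x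
    exact (Submodule.Quotient.mk_eq_zero _).2 ⟨x, rfl⟩

end Lowering

section Raising

variable {M C K : ℕ → Type*}
  [∀ n, AddCommGroup (M n)] [∀ n, Module R (M n)]
  [∀ n, AddCommGroup (C n)] [∀ n, Module R (C n)]
  [∀ n, AddCommGroup (K n)] [∀ n, Module R (K n)]

/-- Graded submodules of a sequence of modules with operators `x j` of degree `1`, `j ∈ s`. -/
abbrev RaisingSubmodule (x : ι → ∀ n, M n →ₗ[R] M (n + 1)) (s : Finset ι) :=
  {U : ∀ n, Submodule R (M n) // ∀ j ∈ s, ∀ n, U n ≤ (U (n + 1)).comap (x j n)}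

/-- The ascending chain condition on graded submodules for operators of degree `1`. -/
def IsRaisingNoetherian (x : ι → ∀ n, M n →ₗ[R] M (n + 1)) (s : Finset ι) : Prop :=
  WellFoundedGT (RaisingSubmodule x s)

lemma IsRaisingNoetherian.of_injective {s : Finset ι}
    {xK : ι → ∀ n, K n →ₗ[R] K (n + 1)} {xM : ι → ∀ n, M n →ₗ[R] M (n + 1)}
    (hM : IsRaisingNoetherian xM s) (f : ∀ n, K n →ₗ[R] M n)
    (hf : ∀ j ∈ s, ∀ n z, f (n + 1) (xK j n z) = xM j n (f n z))
    (hinj : ∀ n, Function.Injective (f n)) : IsRaisingNoetherian xK s := by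
  unfold IsRaisingNoetherian at *
  let φ : RaisingSubmodule xK s → RaisingSubmodule xM s := fun U ↦
    ⟨fun n ↦ (U.1 n).map (f n), fun j hj n ↦ by
        rintro _ ⟨z, hz, rfl⟩
        exact ⟨xK j n z, U.2 j hj n hz, hf j hj n z⟩⟩
  refine StrictMono.wellFoundedGT (f := φ) fun U V hUV ↦
    lt_of_le_not_ge (fun n ↦ Submodule.map_mono (hUV.le n)) fun hVU ↦ hUV.not_ge fun n ↦ ?_
  exact (Submodule.map_le_map_iff_of_injective (hinj n) _ _).1 (hVU n)

lemma IsRaisingNoetherian.of_surjective {s : Finset ι}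
    {xM : ι → ∀ n, M n →ₗ[R] M (n + 1)} {xC : ι → ∀ n, C n →ₗ[R] C (n + 1)}
    (hM : IsRaisingNoetherian xM s) (g : ∀ n, M n →ₗ[R] C n)
    (hg : ∀ j ∈ s, ∀ n z, g (n + 1) (xM j n z) = xC j n (g n z))
    (hsurj : ∀ n, Function.Surjective (g n)) : IsRaisingNoetherian xC s := by
  unfold IsRaisingNoetherian at *
  let φ : RaisingSubmodule xC s → RaisingSubmodule xM s := fun U ↦
    ⟨fun n ↦ (U.1 n).comap (g n), fun j hj n z hz ↦ by
        simpa only [Submodule.mem_comap, hg j hj] using U.2 j hj n hz⟩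
  refine StrictMono.wellFoundedGT (f := φ) fun U V hUV ↦
    lt_of_le_not_ge (fun n ↦ Submodule.comap_mono (hUV.le n)) fun hVU ↦ hUV.not_ge fun n ↦ ?_
  exact (Submodule.comap_le_comap_iff_of_surjective (hsurj n)).1 (hVU n)

/-- A sequence of modules with degree `1` operators is Noetherian once the cokernel of one of the
commuting operators is Noetherian with respect to the remaining ones. -/
lemma IsRaisingNoetherian.insert_of_coker [DecidableEq ι] {s : Finset ι} {a : ι}
    {xM : ι → ∀ n, M n →ₗ[R] M (n + 1)} {xC : ι → ∀ n, C n →ₗ[R] C (n + 1)}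
    (hcomm : ∀ j k n z, xM j (n + 1) (xM k n z) = xM k (n + 1) (xM j n z))
    (hC : IsRaisingNoetherian xC s) (hM : IsNoetherian R (M 0))
    (g : ∀ n, M (n + 1) →ₗ[R] C n)
    (hg : ∀ j ∈ s, ∀ n z, g (n + 1) (xM j (n + 1) z) = xC j n (g n z))
    (H : ∀ n z, g n z = 0 → ∃ w, xM a n w = z) : IsRaisingNoetherian xM (insert a s) := by
  unfold IsRaisingNoetherian at *
  let T : RaisingSubmodule xM (insert a s) → RaisingSubmodule xM (insert a s) := fun U ↦
    ⟨fun n ↦ (U.1 (n + 1)).comap (xM a n), fun j hj n z hz ↦ by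
      simpa only [Submodule.mem_comap, hcomm a j] using U.2 j hj (n + 1) hz⟩
  have hT : Monotone T := fun U V hUV n ↦ Submodule.comap_mono (hUV (n + 1))
  have hTle (U) : U ≤ T U := fun n z hz ↦ U.2 a (Finset.mem_insert_self _ _) n hz
  let δ : RaisingSubmodule xM (insert a s) → Submodule R (M 0) × RaisingSubmodule xC s :=
    fun U ↦ (U.1 0, ⟨fun n ↦ (U.1 (n + 1)).map (g n), fun j hj n ↦ by
      rintro _ ⟨z, hz, rfl⟩
      exact ⟨xM j (n + 1) z, U.2 j (Finset.mem_insert_of_mem hj) (n + 1) hz, hg j hj n z⟩⟩)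
  have hδ : Monotone δ := fun U V hUV ↦ ⟨hUV 0, fun n ↦ Submodule.map_mono (hUV (n + 1))⟩
  have hwf : WellFoundedLT (Submodule R (M 0) × RaisingSubmodule xC s)ᵒᵈ :=
    ⟨(inferInstance : WellFoundedGT (Submodule R (M 0) × RaisingSubmodule xC s)).wf⟩
  suffices WellFoundedLT (RaisingSubmodule xM (insert a s))ᵒᵈ from ⟨this.wf⟩
  refine wellFoundedLT_of_antitone_detecting
    (fun k U ↦ OrderDual.toDual (δ (T^[k] (OrderDual.ofDual U))))
    (fun k ↦ (hδ.comp (hT.iterate k)).dual) (fun k U ↦ ?_) fun V U hUV h ↦ ?_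
  · rw [Function.iterate_succ_apply']
    exact hδ (hTle _)
  · replace h (k) : δ (T^[k] (OrderDual.ofDual V)) = δ (T^[k] (OrderDual.ofDual U)) := h k
    refine le_antisymm hUV ?_
    change OrderDual.ofDual V ≤ OrderDual.ofDual U
    replace hUV : OrderDual.ofDual U ≤ OrderDual.ofDual V := hUV
    generalize OrderDual.ofDual U = U at *
    generalize OrderDual.ofDual V = V at *
    suffices ∀ n k, (T^[k] V).1 n ≤ (T^[k] U).1 n from fun n ↦ this n 0
    intro n
    induction n with
    | zero => exact fun k ↦ (congrArg Prod.fst (h k)).le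
    | succ n ih =>
      intro k v hv
      have hle : T^[k] U ≤ T^[k] V := hT.iterate k hUV
      have hv' : g n v ∈ (δ (T^[k] V)).2.1 n := ⟨v, hv, rfl⟩
      rw [h k] at hv'
      obtain ⟨u, hu, huv⟩ := hv'
      obtain ⟨w, hw⟩ := H n (v - u) (by rw [map_sub, huv, sub_self])
      have hw' : w ∈ (T^[k + 1] V).1 n := by
        rw [Function.iterate_succ_apply']
        change xM a n w ∈ (T^[k] V).1 (n + 1)
        rw [hw]
        exact sub_mem hv (hle _ hu)
      have hw'' := ih (k + 1) hw'
      rw [Function.iterate_succ_apply'] at hw''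
      have : v - u ∈ (T^[k] U).1 (n + 1) := hw ▸ hw''
      simpa using add_mem this hu

lemma IsRaisingNoetherian.of_eventually_subsingleton (x : ι → ∀ n, M n →ₗ[R] M (n + 1))
    (s : Finset ι) (hM : ∀ n, IsNoetherian R (M n)) (n₀ : ℕ)
    (h : ∀ n, n₀ ≤ n → Subsingleton (M n)) : IsRaisingNoetherian x s := by
  unfold IsRaisingNoetherian
  have hwf : WellFoundedGT (∀ i : Fin n₀, Submodule R (M i)) :=
    ⟨(inferInstance : WellFoundedLT (∀ i : Fin n₀, (Submodule R (M i))ᵒᵈ)).wf⟩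
  refine StrictMono.wellFoundedGT
    (f := fun (U : RaisingSubmodule x s) (i : Fin n₀) ↦ U.1 i) fun U V hUV ↦
    lt_of_le_not_ge (fun i ↦ hUV.le i) fun hVU ↦ hUV.not_ge fun n ↦ ?_
  rcases lt_or_ge n n₀ with hn | hn
  · exact hVU ⟨n, hn⟩
  · have := h n hn
    exact (Subsingleton.elim _ _).le

lemma IsRaisingNoetherian.eventually_subsingleton (x : ι → ∀ n, M n →ₗ[R] M (n + 1))
    (h : IsRaisingNoetherian x ∅) : ∃ n₀, ∀ n, n₀ ≤ n → Subsingleton (M n) := by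
  unfold IsRaisingNoetherian at h
  let u : ℕ → RaisingSubmodule x ∅ := fun k ↦
    ⟨fun n ↦ if k ≤ n then ⊥ else ⊤, fun _ hj ↦ absurd hj (Finset.notMem_empty _)⟩
  have hu : Monotone u := by
    intro k l hkl n
    dsimp only [u]
    split_ifs with h₁ h₂
    · exact le_rfl
    · exact bot_le
    · omega
    · exact le_rfl
  obtain ⟨n₀, hn₀⟩ := WellFoundedGT.monotone_chain_condition (α := RaisingSubmodule x ∅) ⟨u, hu⟩
  refine ⟨n₀, fun n hn ↦ ?_⟩
  have := congrFun (congrArg Subtype.val (hn₀ (n + 1) (by omega))) n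
  simp only [u, OrderHom.coe_mk, hn, if_true, Nat.not_succ_le_self, if_false] at this
  exact (Submodule.subsingleton_iff R).1
    (subsingleton_of_top_le_bot (α := Submodule R (M n)) this.ge)

lemma IsRaisingNoetherian.shift {x : ι → ∀ n, M n →ₗ[R] M (n + 1)} {s : Finset ι}
    (h : IsRaisingNoetherian x s) :
    IsRaisingNoetherian (M := fun n ↦ M (n + 1)) (fun j n ↦ x j (n + 1)) s := by
  unfold IsRaisingNoetherian at *
  let φ : RaisingSubmodule (M := fun n ↦ M (n + 1)) (fun j n ↦ x j (n + 1)) s →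
      RaisingSubmodule x s := fun U ↦
    ⟨fun | 0 => ⊥ | n + 1 => U.1 n, fun j hj n ↦ match n with
      | 0 => bot_le
      | n + 1 => U.2 j hj n⟩
  refine StrictMono.wellFoundedGT (f := φ) fun U V hUV ↦
    lt_of_le_not_ge (fun n ↦ ?_) fun hVU ↦ hUV.not_ge fun n ↦ hVU (n + 1)
  cases n with
  | zero => exact le_rfl
  | succ n => exact hUV.le n

lemma IsRaisingNoetherian.of_insert_of_eq_zero [DecidableEq ι]
    {x : ι → ∀ n, M n →ₗ[R] M (n + 1)} {s : Finset ι} {a : ι}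
    (h : IsRaisingNoetherian x (insert a s)) (ha : ∀ n z, x a n z = 0) :
    IsRaisingNoetherian x s := by
  unfold IsRaisingNoetherian at *
  let φ : RaisingSubmodule x s → RaisingSubmodule x (insert a s) := fun U ↦
    ⟨U.1, fun j hj n z hz ↦ by
      obtain rfl | hj := Finset.mem_insert.1 hj
      · simp [ha]
      · exact U.2 j hj n hz⟩
  exact StrictMono.wellFoundedGT (f := φ) fun U V hUV ↦ hUV

/-- The operators induced on the kernels of the operator `x a`. -/
def raisingKer (x : ι → ∀ n, M n →ₗ[R] M (n + 1))
    (hcomm : ∀ j k n z, x j (n + 1) (x k n z) = x k (n + 1) (x j n z)) (a j : ι) (n : ℕ) :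
    LinearMap.ker (x a n) →ₗ[R] LinearMap.ker (x a (n + 1)) :=
  (x j n).restrict fun z hz ↦ by
    rw [LinearMap.mem_ker] at hz ⊢
    rw [hcomm, hz, map_zero]

/-- The operators induced on the images of the operator `x a`. -/
def raisingRange (x : ι → ∀ n, M n →ₗ[R] M (n + 1))
    (hcomm : ∀ j k n z, x j (n + 1) (x k n z) = x k (n + 1) (x j n z)) (a j : ι) (n : ℕ) :
    LinearMap.range (x a n) →ₗ[R] LinearMap.range (x a (n + 1)) :=
  (x j (n + 1)).restrict fun z hz ↦ by
    obtain ⟨w, rfl⟩ := hz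
    exact ⟨x j n w, hcomm _ _ _ _⟩

/-- The operators induced on the cokernels of the operator `x a`. -/
def raisingCoker (x : ι → ∀ n, M n →ₗ[R] M (n + 1))
    (hcomm : ∀ j k n z, x j (n + 1) (x k n z) = x k (n + 1) (x j n z)) (a j : ι) (n : ℕ) :
    (M (n + 1) ⧸ LinearMap.range (x a n)) →ₗ[R] M (n + 2) ⧸ LinearMap.range (x a (n + 1)) :=
  Submodule.mapQ _ _ (x j (n + 1)) fun z hz ↦ by
    obtain ⟨w, rfl⟩ := hz
    exact ⟨x j n w, hcomm _ _ _ _⟩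

lemma IsRaisingNoetherian.ker [DecidableEq ι]
    {x : ι → ∀ n, M n →ₗ[R] M (n + 1)} {s : Finset ι} {a : ι}
    (h : IsRaisingNoetherian x (insert a s))
    (hcomm : ∀ j k n z, x j (n + 1) (x k n z) = x k (n + 1) (x j n z)) :
    IsRaisingNoetherian (M := fun n ↦ LinearMap.ker (x a n)) (raisingKer x hcomm a) s :=
  .of_insert_of_eq_zero (a := a)
    (.of_injective h (fun n ↦ (LinearMap.ker (x a n)).subtype) (fun _ _ _ _ ↦ rfl)
      fun _ ↦ Subtype.val_injective) fun _ z ↦ Subtype.ext z.2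

lemma IsRaisingNoetherian.coker [DecidableEq ι]
    {x : ι → ∀ n, M n →ₗ[R] M (n + 1)} {s : Finset ι} {a : ι}
    (h : IsRaisingNoetherian x (insert a s))
    (hcomm : ∀ j k n z, x j (n + 1) (x k n z) = x k (n + 1) (x j n z)) :
    IsRaisingNoetherian (M := fun n ↦ M (n + 1) ⧸ LinearMap.range (x a n))
      (raisingCoker x hcomm a) s := by
  refine .of_insert_of_eq_zero (a := a)
    (.of_surjective h.shift (fun n ↦ (LinearMap.range (x a n)).mkQ) (fun _ _ _ _ ↦ rfl)
      fun _ ↦ Submodule.mkQ_surjective _) fun n z ↦ ?_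
  obtain ⟨z, rfl⟩ := Submodule.mkQ_surjective _ z
  exact (Submodule.Quotient.mk_eq_zero _).2 ⟨z, rfl⟩

lemma IsRaisingNoetherian.of_generated {M : ℕ → Type*} [∀ n, AddCommGroup (M n)]
    [∀ n, Module R (M n)] [hM : ∀ n, IsNoetherian R (M n)]
    (x : ι → ∀ n, M n →ₗ[R] M (n + 1)) (s : Finset ι)
    (hcomm : ∀ j k n z, x j (n + 1) (x k n z) = x k (n + 1) (x j n z)) (n₀ : ℕ)
    (hgen : ∀ n, n₀ ≤ n → ⨆ j ∈ s, LinearMap.range (x j n) = ⊤) :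
    IsRaisingNoetherian x s := by
  classical
  induction s using Finset.induction_on generalizing M n₀ with
  | empty =>
    refine .of_eventually_subsingleton x _ hM (n₀ + 1) fun n hn ↦ ?_
    obtain ⟨n, rfl⟩ : ∃ m, n = m + 1 := ⟨n - 1, by omega⟩
    have := hgen n (by omega)
    simp only [Finset.notMem_empty, iSup_false, iSup_bot] at this
    exact (Submodule.subsingleton_iff R).1 (subsingleton_of_bot_eq_top this)
  | insert a s ha ih =>
    refine .insert_of_coker hcomm (ih (M := fun n ↦ M (n + 1) ⧸ LinearMap.range (x a n))
      (raisingCoker x hcomm a) (fun j k n z ↦ ?_) n₀ fun n hn ↦ ?_) (hM 0)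
      (fun n ↦ (LinearMap.range (x a n)).mkQ) (fun _ _ _ _ ↦ rfl)
      fun n z hz ↦ (Submodule.Quotient.mk_eq_zero _).1 hz
    · obtain ⟨z, rfl⟩ := Submodule.mkQ_surjective _ z
      exact congrArg (Submodule.mkQ _) (hcomm j k (n + 1) z)
    · have h := congrArg (Submodule.map (LinearMap.range (x a (n + 1))).mkQ)
        (hgen (n + 1) (by omega))
      rw [Finset.iSup_insert, Submodule.map_sup, Submodule.mkQ_map_self, bot_sup_eq,
        Submodule.map_top, Submodule.range_mkQ] at h
      rw [eq_top_iff, ← h]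
      simp only [Submodule.map_iSup]
      refine iSup₂_mono fun j hj ↦ ?_
      rintro _ ⟨_, ⟨z, rfl⟩, rfl⟩
      exact ⟨(LinearMap.range (x a n)).mkQ z, rfl⟩

end Raising

end GradedSystems

/-- `h` is finite and agrees with a rational polynomial in large degrees. -/
def IsEventuallyPolynomial (h : ℕ → ℕ∞) : Prop :=
  ∃ (p : Polynomial ℚ) (N₀ : ℕ), ∀ n ≥ N₀, ∃ ℓ : ℕ, h n = ℓ ∧ (ℓ : ℚ) = p.eval (n : ℚ)

lemma Polynomial.exists_eval_add_one_sub_eval (q : Polynomial ℚ) :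
    ∃ p : Polynomial ℚ, ∀ x, p.eval (1 + x) - p.eval x = q.eval x := by
  induction q using Polynomial.induction_on' with
  | add p q hp hq =>
    obtain ⟨P, hP⟩ := hp
    obtain ⟨Q, hQ⟩ := hq
    exact ⟨P + Q, fun x ↦ by rw [eval_add, eval_add, eval_add, ← hP, ← hQ]; ring⟩
  | monomial n a =>
    refine ⟨C (a / (n + 1)) * bernoulli (n + 1), fun x ↦ ?_⟩
    simp only [eval_mul, eval_C, bernoulli_eval_one_add, eval_monomial]
    have : (n : ℚ) + 1 ≠ 0 := by positivity
    push_cast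
    field_simp
    ring

lemma IsEventuallyPolynomial.of_add_eq {h k c : ℕ → ℕ∞} (hk : IsEventuallyPolynomial k)
    (hc : IsEventuallyPolynomial c) (n₀ : ℕ) (hh : ∀ n, n₀ ≤ n → h n ≠ ⊤)
    (hadd : ∀ n, n₀ ≤ n → h (n + 1) + c n = h n + k n) : IsEventuallyPolynomial h := by
  obtain ⟨p, N, hp⟩ := hk
  obtain ⟨q, N', hq⟩ := hc
  obtain ⟨P, hP⟩ := (p - q).exists_eval_add_one_sub_eval
  set m := max n₀ (max N N') with hm
  refine ⟨P + Polynomial.C (((h m).toNat : ℚ) - P.eval (m : ℚ)), m, fun n hn ↦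
    ⟨(h n).toNat, (ENat.natCast_toNat (hh n (by omega))).symm, ?_⟩⟩
  induction n, hn using Nat.le_induction with
  | base => simp
  | succ n hn ih =>
    obtain ⟨l, hl, hl'⟩ := hp n (by omega)
    obtain ⟨r, hr, hr'⟩ := hq n (by omega)
    have e := hadd n (by omega)
    rw [hl, hr, ← ENat.natCast_toNat (hh n (by omega)),
      ← ENat.natCast_toNat (hh (n + 1) (by omega))] at e
    have e' : ((h (n + 1)).toNat : ℚ) + r = (h n).toNat + l := by exact_mod_cast e
    have := hP n
    simp only [Polynomial.eval_add, Polynomial.eval_C, Polynomial.eval_sub] at ih this ⊢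
    push_cast
    rw [add_comm (n : ℚ) 1]
    linarith

lemma LinearMap.length_add_length_coker {R M N : Type*} [Ring R] [AddCommGroup M] [Module R M]
    [AddCommGroup N] [Module R N] (f : M →ₗ[R] N) :
    Module.length R M + Module.length R (N ⧸ LinearMap.range f) =
      Module.length R N + Module.length R (LinearMap.ker f) := by
  rw [Module.length_eq_add_of_exact (LinearMap.ker f).subtype f.rangeRestrict
      Subtype.val_injective f.surjective_rangeRestrict
      (by rw [LinearMap.exact_iff, LinearMap.ker_rangeRestrict, Submodule.range_subtype]),
    Module.length_eq_add_of_exact (LinearMap.range f).subtype (LinearMap.range f).mkQ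
      Subtype.val_injective (Submodule.mkQ_surjective _)
      (by rw [LinearMap.exact_iff, Submodule.ker_mkQ, Submodule.range_subtype])]
  ac_rfl

/-- The Hilbert polynomial of an Artinian graded module. -/
theorem IsLoweringArtinian.isEventuallyPolynomial_length {R ι : Type*} [Ring R] {E : ℕ → Type*}
    [∀ n, AddCommGroup (E n)] [∀ n, Module R (E n)]
    (y : ι → ∀ n, E (n + 1) →ₗ[R] E n) (s : Finset ι)
    (hcomm : ∀ j k n x, y j n (y k (n + 1) x) = y k n (y j (n + 1) x))
    (h : IsLoweringArtinian y s) (n₀ : ℕ) (hfin : ∀ n, n₀ ≤ n → IsFiniteLength R (E n)) :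
    IsEventuallyPolynomial fun n ↦ Module.length R (E n) := by
  classical
  induction s using Finset.induction_on generalizing E n₀ with
  | empty =>
    obtain ⟨N, hN⟩ := h.eventually_subsingleton
    refine ⟨0, N, fun n hn ↦ ⟨0, ?_, by simp⟩⟩
    have := hN n hn
    simp
  | insert a s ha ih =>
    refine .of_add_eq (h := fun n ↦ Module.length R (E n))
      (k := fun n ↦ Module.length R (LinearMap.ker (y a n)))
      (c := fun n ↦ Module.length R (E n ⧸ LinearMap.range (y a n))) ?_ ?_ n₀
      (fun n hn ↦ Module.length_ne_top_iff.2 (hfin n hn))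
      fun n _ ↦ (y a n).length_add_length_coker
    · exact ih (E := fun n ↦ LinearMap.ker (y a n)) (loweringKer y hcomm a)
        (fun j k n x ↦ Subtype.ext (hcomm j k _ _)) (h.ker hcomm) n₀
        fun n hn ↦ (hfin (n + 1) (by omega)).of_injective
          (f := (LinearMap.ker (y a n)).subtype) Subtype.val_injective
    · refine ih (E := fun n ↦ E n ⧸ LinearMap.range (y a n)) (loweringCoker y hcomm a)
        (fun j k n x ↦ ?_) (h.coker hcomm) n₀
        fun n hn ↦ (hfin n hn).of_surjective (Submodule.mkQ_surjective _)
      obtain ⟨x, rfl⟩ := Submodule.mkQ_surjective _ x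
      exact congrArg (Submodule.mkQ _) (hcomm j k n x)

open Abelian CochainComplex HomComplex in
lemma CategoryTheory.ProjectiveResolution.extMk_zero_eq_zero_iff {C : Type*} [Category C]
    [Abelian C] [HasExt C] {X Y : C} (P : ProjectiveResolution X) (f : P.complex.X 0 ⟶ Y) (m : ℕ)
    (hm : 0 + 1 = m) (hf : P.complex.d m 0 ≫ f = 0) : P.extMk f m hm hf = 0 ↔ f = 0 := by
  refine ⟨fun h ↦ ?_, fun h ↦ by simp [h]⟩
  rw [← P.extEquivCohomologyClass.apply_eq_iff_eq, extEquivCohomologyClass_extMk,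
    extEquivCohomologyClass_zero, CohomologyClass.mk_eq_zero_iff,
    Cocycle.toSingleMk_mem_coboundaries_iff _ _ _ _ _ 1 (by simp)] at h
  obtain ⟨g, hg⟩ := h
  have hz : Limits.IsZero (P.cochainComplex.X 1) :=
    P.cochainComplex.isZero_of_isStrictlyLE 0 1
  rw [hz.eq_of_src g 0] at hg
  rw [← cancel_epi (P.cochainComplexXIso (-0) 0 rfl).hom]
  simpa using hg.symm

/-- The cohomology of `Hom(P, Y)` for a projective resolution `P` of `X` is `Ext X Y`. -/
lemma CategoryTheory.ProjectiveResolution.nonempty_homology_linearEquiv_ext {R : Type u}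
    [CommRing R] {X Y : ModuleCat.{u} R} (P : ProjectiveResolution X) (n : ℕ) :
    Nonempty ((P.complex.linearYonedaObj R Y).homology n ≃ₗ[R] Abelian.Ext X Y n) := by
  let K := P.complex.linearYonedaObj R Y
  let S := K.sc n
  have hm : n + 1 = (ComplexShape.up ℕ).next n := by simp
  let φ : LinearMap.ker S.g.hom →ₗ[R] Abelian.Ext X Y n :=
    { toFun f := P.extMk f.1 _ hm f.2
      map_add' f g := (P.add_extMk f.1 g.1 _ hm f.2 g.2).symm
      map_smul' r f := by
        refine ((Abelian.Ext.smul_eq_comp_mk₀ _ r).trans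
          ((P.extMk_comp_mk₀ f.1 _ hm f.2 _).trans ?_)).symm
        congr 1 }
  have hφ : Function.Surjective φ := fun α ↦ by
    obtain ⟨f, hf, rfl⟩ := P.extMk_surjective α _ hm
    exact ⟨⟨f, hf⟩, rfl⟩
  have hker : LinearMap.ker φ = LinearMap.range S.moduleCatToCycles := by
    ext f
    rw [LinearMap.mem_ker, LinearMap.mem_range]
    cases n with
    | zero =>
      refine (P.extMk_zero_eq_zero_iff f.1 _ hm f.2).trans ⟨fun h ↦ ⟨0, ?_⟩, ?_⟩
      · rw [map_zero]
        exact (Subtype.ext h).symm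
      · rintro ⟨g, rfl⟩
        have hd : S.f = 0 := K.shape _ _ (by simp)
        change S.f.hom g = 0
        rw [hd]
        rfl
    | succ p =>
      have hp : (ComplexShape.up ℕ).prev (p + 1) + 1 = p + 1 := by simp
      refine (P.extMk_eq_zero_iff f.1 _ hm f.2 _ hp).trans ⟨?_, ?_⟩
      · rintro ⟨g, hg⟩
        exact ⟨g, Subtype.ext hg⟩
      · rintro ⟨g, rfl⟩
        exact ⟨g, rfl⟩
  exact ⟨S.moduleCatHomologyIso.toLinearEquiv ≪≫ₗ
    Submodule.quotEquivOfEq _ _ hker.symm ≪≫ₗ φ.quotKerEquivOfSurjective hφ⟩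

lemma nonempty_ext_linearEquiv_abelianExt {R : Type u} [CommRing R] (X Y : ModuleCat.{u} R)
    (n : ℕ) : Nonempty (((Ext R (ModuleCat.{u} R) n).obj (Opposite.op X)).obj Y ≃ₗ[R]
      Abelian.Ext X Y n) := by
  obtain ⟨e⟩ := (projectiveResolution X).nonempty_homology_linearEquiv_ext (Y := Y) n
  exact ⟨((projectiveResolution X).isoExt n Y).toLinearEquiv ≪≫ₗ e⟩

section ExtPrecomp

open Abelian

variable {R : Type u} [CommRing R] {K M C K' M' C' : Type u}
  [AddCommGroup K] [Module R K] [AddCommGroup M] [Module R M] [AddCommGroup C] [Module R C]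
  [AddCommGroup K'] [Module R K'] [AddCommGroup M'] [Module R M']
  [AddCommGroup C'] [Module R C']

/-- The map `Ext^i(C, A) → Ext^i(M, A)` induced by `f : M → C`. -/
noncomputable def extPrecomp (A : ModuleCat.{u} R) (i : ℕ) (f : M →ₗ[R] C) :
    Abelian.Ext (ModuleCat.of R C) A i →ₗ[R] Abelian.Ext (ModuleCat.of R M) A i :=
  (Ext.mk₀ (ModuleCat.ofHom f)).precompOfLinear R A (zero_add i)

variable (A : ModuleCat.{u} R) (i : ℕ)

lemma extPrecomp_comp (f : K →ₗ[R] M) (g : M →ₗ[R] C)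
    (x : Abelian.Ext (ModuleCat.of R C) A i) :
    extPrecomp A i f (extPrecomp A i g x) = extPrecomp A i (g ∘ₗ f) x := by
  simp only [extPrecomp, Ext.bilinearCompOfLinear_apply_apply]
  rw [Ext.mk₀_comp_mk₀_assoc]
  rfl

lemma extPrecomp_zero (x : Abelian.Ext (ModuleCat.of R C) A i) :
    extPrecomp A i (0 : M →ₗ[R] C) x = 0 := by
  simp only [extPrecomp, Ext.bilinearCompOfLinear_apply_apply, ModuleCat.ofHom_zero,
    Ext.mk₀_zero, Ext.zero_comp]

lemma extPrecomp_congr_comp {f : K →ₗ[R] M} {g : M →ₗ[R] C} {f' : K →ₗ[R] M'}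
    {g' : M' →ₗ[R] C} (h : g ∘ₗ f = g' ∘ₗ f') (x : Abelian.Ext (ModuleCat.of R C) A i) :
    extPrecomp A i f (extPrecomp A i g x) = extPrecomp A i f' (extPrecomp A i g' x) := by
  rw [extPrecomp_comp, extPrecomp_comp, h]

/-- The short complex attached to an exact pair of linear maps. -/
abbrev exactShortComplex {f : K →ₗ[R] M} {g : M →ₗ[R] C} (h : Function.Exact f g) :
    ShortComplex (ModuleCat.{u} R) :=
  ShortComplex.mk (ModuleCat.ofHom f) (ModuleCat.ofHom g)
    (by rw [← ModuleCat.ofHom_comp, h.linearMap_comp_eq_zero, ModuleCat.ofHom_zero])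

lemma exactShortComplex_shortExact {f : K →ₗ[R] M} {g : M →ₗ[R] C} (h : Function.Exact f g)
    (hf : Function.Injective f) (hg : Function.Surjective g) :
    (exactShortComplex h).ShortExact where
  exact := (ShortComplex.ShortExact.moduleCat_exact_iff_function_exact _).2 h
  mono_f := (ModuleCat.mono_iff_injective _).2 hf
  epi_g := (ModuleCat.epi_iff_surjective _).2 hg

lemma exists_extPrecomp_eq {f : K →ₗ[R] M} {g : M →ₗ[R] C} (h : Function.Exact f g)
    (hf : Function.Injective f) (hg : Function.Surjective g)
    (x : Abelian.Ext (ModuleCat.of R M) A i) (hx : extPrecomp A i f x = 0) :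
    ∃ z, extPrecomp A i g z = x :=
  Ext.contravariant_sequence_exact₂ (exactShortComplex_shortExact h hf hg) A x hx

lemma extPrecomp_zero_injective {g : M →ₗ[R] C} (hg : Function.Surjective g) :
    Function.Injective (extPrecomp A 0 g) := by
  have : Epi (ModuleCat.ofHom g) := (ModuleCat.epi_iff_surjective _).2 hg
  exact Ext.precomp_mk₀_injective_of_epi A (ModuleCat.ofHom g)

/-- The connecting map `Ext^i(K, A) → Ext^{i+1}(C, A)`. -/
noncomputable def extConnecting {f : K →ₗ[R] M} {g : M →ₗ[R] C} (h : Function.Exact f g)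
    (hf : Function.Injective f) (hg : Function.Surjective g) :
    Abelian.Ext (ModuleCat.of R K) A i →ₗ[R] Abelian.Ext (ModuleCat.of R C) A (i + 1) :=
  (exactShortComplex_shortExact h hf hg).extClass.precompOfLinear R A (add_comm 1 i)

lemma exists_extConnecting_eq {f : K →ₗ[R] M} {g : M →ₗ[R] C} (h : Function.Exact f g)
    (hf : Function.Injective f) (hg : Function.Surjective g)
    (x : Abelian.Ext (ModuleCat.of R C) A (i + 1)) (hx : extPrecomp A (i + 1) g x = 0) :
    ∃ z, extConnecting A i h hf hg z = x :=
  Ext.contravariant_sequence_exact₃ (exactShortComplex_shortExact h hf hg) A x hx (add_comm 1 i)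

lemma extPrecomp_extConnecting {f : K →ₗ[R] M} {g : M →ₗ[R] C} (h : Function.Exact f g)
    (hf : Function.Injective f) (hg : Function.Surjective g)
    (x : Abelian.Ext (ModuleCat.of R K) A i) :
    extPrecomp A (i + 1) g (extConnecting A i h hf hg x) = 0 :=
  (exactShortComplex_shortExact h hf hg).comp_extClass_assoc x (add_comm 1 i)

lemma extConnecting_naturality {f : K →ₗ[R] M} {g : M →ₗ[R] C} (h : Function.Exact f g)
    (hf : Function.Injective f) (hg : Function.Surjective g)
    {f' : K' →ₗ[R] M'} {g' : M' →ₗ[R] C'} (h' : Function.Exact f' g')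
    (hf' : Function.Injective f') (hg' : Function.Surjective g')
    (a : K →ₗ[R] K') (b : M →ₗ[R] M') (c : C →ₗ[R] C')
    (hab : f' ∘ₗ a = b ∘ₗ f) (hbc : g' ∘ₗ b = c ∘ₗ g)
    (x : Abelian.Ext (ModuleCat.of R K') A i) :
    extConnecting A i h hf hg (extPrecomp A i a x) =
      extPrecomp A (i + 1) c (extConnecting A i h' hf' hg' x) := by
  let φ : exactShortComplex h ⟶ exactShortComplex h' :=
    { τ₁ := ModuleCat.ofHom a
      τ₂ := ModuleCat.ofHom b
      τ₃ := ModuleCat.ofHom c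
      comm₁₂ := by
        simp only [← ModuleCat.ofHom_comp, hab]
      comm₂₃ := by
        simp only [← ModuleCat.ofHom_comp, hbc] }
  have key := ShortComplex.ShortExact.extClass_naturality
    (exactShortComplex_shortExact h hf hg) (exactShortComplex_shortExact h' hf' hg') φ
  have := congrArg (fun e ↦ e.comp x (add_comm 1 i)) key
  rw [Ext.comp_assoc_of_second_deg_zero,
    Ext.comp_assoc _ _ _ (zero_add 1) (add_comm 1 i) (by omega)] at this
  exact this

end ExtPrecomp

section ExtSystems

open Abelian

variable {R : Type u} [CommRing R]

instance isArtinian_abelianExt [IsNoetherianRing R] (N A : ModuleCat.{u} R)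
    [Module.Finite R N] [IsArtinian R A] (i : ℕ) : IsArtinian R (Abelian.Ext N A i) := by
  induction i generalizing N with
  | zero =>
    obtain ⟨n, f, hf⟩ := Module.Finite.exists_fin' R N
    let e : Abelian.Ext N A 0 ≃ₗ[R] (N →ₗ[R] A) :=
      Ext.linearEquiv₀.trans ModuleCat.homLinearEquiv
    let e' : ((Fin n → R) →ₗ[R] A) ≃ₗ[R] (Fin n → A) := (Pi.basisFun R (Fin n)).constr R |>.symm
    exact isArtinian_of_injective
      (e'.toLinearMap ∘ₗ LinearMap.lcomp R A f ∘ₗ e.toLinearMap)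
      (e'.injective.comp ((LinearMap.lcomp_injective_of_surjective f hf).comp e.injective))
  | succ n ih =>
    obtain ⟨P, _, _, _, _, f, surjf⟩ := Module.exists_finite_presentation R N
    let exac := LinearMap.shortExact_shortComplexKer surjf
    exact isArtinian_of_surjective _ (exac.extClass.precompOfLinear R A (add_comm 1 n))
      (precomp_extClass_surjective_of_projective_X₂ A exac n)

/-- If a graded module is Noetherian, its graded `Ext` into an Artinian module is Artinian. -/
theorem IsRaisingNoetherian.isLoweringArtinian_ext {ι : Type*} [IsNoetherianRing R]
    (A : ModuleCat.{u} R) [IsArtinian R A] {M : ℕ → Type u} [∀ n, AddCommGroup (M n)]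
    [∀ n, Module R (M n)] [hM : ∀ n, IsNoetherian R (M n)]
    (x : ι → ∀ n, M n →ₗ[R] M (n + 1)) (s : Finset ι)
    (hcomm : ∀ j k n z, x j (n + 1) (x k n z) = x k (n + 1) (x j n z))
    (h : IsRaisingNoetherian x s) (i : ℕ) :
    IsLoweringArtinian (E := fun n ↦ Abelian.Ext (ModuleCat.of R (M n)) A i)
      (fun j n ↦ extPrecomp A i (x j n)) s := by
  classical
  induction s using Finset.induction_on generalizing M i with
  | empty =>
    obtain ⟨N, hN⟩ := h.eventually_subsingleton
    refine .of_eventually_subsingleton _ _ (fun n ↦ inferInstance) N fun n hn ↦ ?_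
    have := hN n hn
    have hz : Limits.IsZero (ModuleCat.of R (M n)) := ModuleCat.isZero_of_subsingleton _
    refine subsingleton_of_forall_eq 0 fun e ↦ ?_
    rw [← Ext.mk₀_id_comp e, hz.eq_of_src (𝟙 _) 0, Ext.mk₀_zero, Ext.zero_comp]
  | insert a s ha ih =>
    have hcommE (j k n) (e : Abelian.Ext (ModuleCat.of R (M (n + 2))) A i) :
        extPrecomp A i (x j n) (extPrecomp A i (x k (n + 1)) e) =
          extPrecomp A i (x k n) (extPrecomp A i (x j (n + 1)) e) :=
      extPrecomp_congr_comp A i (LinearMap.ext fun z ↦ hcomm k j n z) e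
    have hcoker := ih (M := fun n ↦ M (n + 1) ⧸ LinearMap.range (x a n))
      (raisingCoker x hcomm a) (fun j k n z ↦ by
        obtain ⟨z, rfl⟩ := Submodule.mkQ_surjective _ z
        exact congrArg (Submodule.mkQ _) (hcomm j k (n + 1) z)) (h.coker hcomm) i
    have hker := ih (M := fun n ↦ LinearMap.ker (x a n)) (raisingKer x hcomm a)
      (fun j k n z ↦ Subtype.ext (hcomm j k n z)) (h.ker hcomm)
    have hx₁ (n) : Function.Exact (LinearMap.range (x a n)).subtype (LinearMap.range (x a n)).mkQ :=
      LinearMap.exact_subtype_mkQ _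
    have hx₂ (n) : Function.Exact (LinearMap.ker (x a n)).subtype (x a n).rangeRestrict := by
      rw [LinearMap.exact_iff, LinearMap.ker_rangeRestrict, Submodule.range_subtype]
    let yG (j : ι) (n : ℕ) : LinearMap.ker (extPrecomp A i (x a (n + 1)).rangeRestrict) →ₗ[R]
        LinearMap.ker (extPrecomp A i (x a n).rangeRestrict) :=
      (extPrecomp A i (raisingRange x hcomm a j n)).restrict fun e he ↦ by
        rw [LinearMap.mem_ker] at he ⊢
        rw [extPrecomp_congr_comp A i (f' := x j n) (g' := (x a (n + 1)).rangeRestrict)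
          (LinearMap.ext fun z ↦ Subtype.ext (hcomm j a n z)), he, map_zero]
    have hG : IsLoweringArtinian
        (E := fun n ↦ LinearMap.ker (extPrecomp A i (x a n).rangeRestrict)) yG s := by
      cases i with
      | zero =>
        have (n : ℕ) : Subsingleton (LinearMap.ker (extPrecomp A 0 (x a n).rangeRestrict)) := by
          rw [LinearMap.ker_eq_bot.2
            (extPrecomp_zero_injective A (x a n).surjective_rangeRestrict)]
          infer_instance
        exact isLoweringArtinian_of_subsingleton _ _
      | succ i =>
        refine .of_exact (hker i)
          (isLoweringArtinian_of_subsingleton (R := R) (E := fun _ ↦ PUnit.{1}) (fun _ _ ↦ 0) _)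
          (fun n ↦ (extConnecting A i (hx₂ n) Subtype.val_injective
            (x a n).surjective_rangeRestrict).codRestrict _
              (fun e ↦ extPrecomp_extConnecting A i (hx₂ n) Subtype.val_injective
                (x a n).surjective_rangeRestrict e))
          (fun _ ↦ 0) (fun j _ n e ↦ Subtype.ext ?_) (fun _ _ _ _ ↦ by simp) fun n e _ ↦ ?_
        · exact extConnecting_naturality A i (hx₂ n) Subtype.val_injective
            (x a n).surjective_rangeRestrict (hx₂ (n + 1)) Subtype.val_injective
            (x a (n + 1)).surjective_rangeRestrict (raisingKer x hcomm a j n) (x j n)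
            (raisingRange x hcomm a j n) rfl (LinearMap.ext fun z ↦ Subtype.ext (hcomm a j n z)) e
        · obtain ⟨z, hz⟩ := exists_extConnecting_eq A i (hx₂ n) Subtype.val_injective
            (x a n).surjective_rangeRestrict e.1 e.2
          exact ⟨z, Subtype.ext hz⟩
    refine IsLoweringArtinian.insert_of_ker
      (E := fun n ↦ Abelian.Ext (ModuleCat.of R (M n)) A i)
      (F := fun n ↦ LinearMap.ker (extPrecomp A i (x a n)))
      (yE := fun j n ↦ extPrecomp A i (x j n)) hcommE
      (yK := loweringKer (E := fun n ↦ Abelian.Ext (ModuleCat.of R (M n)) A i)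
        (fun j n ↦ extPrecomp A i (x j n)) hcommE a) ?_ inferInstance
      (fun n ↦ (LinearMap.ker (extPrecomp A i (x a n))).subtype) (fun _ _ _ _ ↦ rfl)
      fun n e he ↦ ⟨⟨e, he⟩, rfl⟩
    refine .of_exact hcoker hG
      (fun n ↦ (extPrecomp A i (LinearMap.range (x a n)).mkQ).codRestrict _ fun e ↦ ?_)
      (fun n ↦ (extPrecomp A i (LinearMap.range (x a n)).subtype).restrict fun e he ↦ ?_)
      (fun j _ n e ↦ Subtype.ext ?_) (fun j _ n e ↦ Subtype.ext ?_) fun n e he ↦ ?_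
    · rw [LinearMap.mem_ker, extPrecomp_comp, LinearMap.range_mkQ_comp, extPrecomp_zero]
    · rw [LinearMap.mem_ker] at he ⊢
      rwa [extPrecomp_comp, LinearMap.subtype_comp_codRestrict]
    · exact extPrecomp_congr_comp A i (f := (LinearMap.range (x a n)).mkQ)
        (g := raisingCoker x hcomm a j n) (f' := x j (n + 1))
        (g' := (LinearMap.range (x a (n + 1))).mkQ) rfl e
    · exact extPrecomp_congr_comp A i (f := (LinearMap.range (x a n)).subtype) (g := x j (n + 1))
        (f' := raisingRange x hcomm a j n) (g' := (LinearMap.range (x a (n + 1))).subtype) rfl e.1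
    · obtain ⟨z, hz⟩ := exists_extPrecomp_eq A i (hx₁ n) Subtype.val_injective
        (Submodule.mkQ_surjective _) e.1 (congrArg Subtype.val he)
      exact ⟨z, Subtype.ext hz⟩

end ExtSystems

/-- The operators induced on the kernels of the transition maps of an inverse system. -/
def transitionKer {R ι : Type*} [Ring R] {Q : ℕ → Type*} [∀ n, AddCommGroup (Q n)]
    [∀ n, Module R (Q n)] (π : ∀ n, Q (n + 1) →ₗ[R] Q n) (x : ι → ∀ n, Q n →ₗ[R] Q (n + 1))
    (hxπ : ∀ j n, π (n + 1) ∘ₗ x j (n + 1) = x j n ∘ₗ π n) (j : ι) (n : ℕ) :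
    LinearMap.ker (π n) →ₗ[R] LinearMap.ker (π (n + 1)) :=
  (x j (n + 1)).restrict fun z hz ↦ by
    rw [LinearMap.mem_ker] at hz ⊢
    rw [← LinearMap.comp_apply, hxπ, LinearMap.comp_apply, hz, map_zero]

section InverseSystems

open Abelian

variable {R : Type u} [CommRing R] {ι : Type*} {Q : ℕ → Type u} [∀ n, AddCommGroup (Q n)]
  [∀ n, Module R (Q n)] (A : ModuleCat.{u} R) (i : ℕ) (π : ∀ n, Q (n + 1) →ₗ[R] Q n)
  (x : ι → ∀ n, Q n →ₗ[R] Q (n + 1))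
  (hxπ : ∀ j n, π (n + 1) ∘ₗ x j (n + 1) = x j n ∘ₗ π n)

/-- The operators induced on the kernels of the maps `Ext^i(Q n, A) → Ext^i(Q (n + 1), A)`. -/
noncomputable def extTransitionKer (j : ι) (n : ℕ) :
    LinearMap.ker (extPrecomp A i (π (n + 1))) →ₗ[R] LinearMap.ker (extPrecomp A i (π n)) :=
  (extPrecomp A i (x j n)).restrict fun e he ↦ by
    rw [LinearMap.mem_ker] at he ⊢
    rw [extPrecomp_congr_comp A i (hxπ j n).symm, he, map_zero]

/-- The operators induced on the cokernels of the maps `Ext^i(Q n, A) → Ext^i(Q (n + 1), A)`. -/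
noncomputable def extTransitionCoker (j : ι) (n : ℕ) :
    (Abelian.Ext (ModuleCat.of R (Q (n + 2))) A i ⧸
      LinearMap.range (extPrecomp A i (π (n + 1)))) →ₗ[R]
      Abelian.Ext (ModuleCat.of R (Q (n + 1))) A i ⧸ LinearMap.range (extPrecomp A i (π n)) :=
  Submodule.mapQ _ _ (extPrecomp A i (x j (n + 1))) fun e he ↦ by
    obtain ⟨w, rfl⟩ := he
    exact ⟨extPrecomp A i (x j n) w, extPrecomp_congr_comp A i (hxπ j n).symm w⟩

variable {π x}

lemma isLoweringArtinian_extTransitionKer (hπ : ∀ n, Function.Surjective (π n)) {s : Finset ι}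
    (h : ∀ i, IsLoweringArtinian
      (E := fun n ↦ Abelian.Ext (ModuleCat.of R (LinearMap.ker (π n))) A i)
      (fun j n ↦ extPrecomp A i (transitionKer π x hxπ j n)) s) :
    IsLoweringArtinian (E := fun n ↦ LinearMap.ker (extPrecomp A i (π n)))
      (extTransitionKer A i π x hxπ) s := by
  cases i with
  | zero =>
    have (n : ℕ) : Subsingleton (LinearMap.ker (extPrecomp A 0 (π n))) := by
      rw [LinearMap.ker_eq_bot.2 (extPrecomp_zero_injective A (hπ n))]
      infer_instance
    exact isLoweringArtinian_of_subsingleton _ _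
  | succ i =>
    have hexact (n) : Function.Exact (LinearMap.ker (π n)).subtype (π n) :=
      LinearMap.exact_subtype_ker_map _
    refine .of_exact (h i)
      (isLoweringArtinian_of_subsingleton (R := R) (E := fun _ ↦ PUnit.{1}) (fun _ _ ↦ 0) _)
      (fun n ↦ (extConnecting A i (hexact n) Subtype.val_injective (hπ n)).codRestrict _
        (fun e ↦ extPrecomp_extConnecting A i (hexact n) Subtype.val_injective (hπ n) e))
      (fun _ ↦ 0) (fun j _ n e ↦ Subtype.ext ?_) (fun _ _ _ _ ↦ by simp) fun n e _ ↦ ?_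
    · exact extConnecting_naturality A i (hexact n) Subtype.val_injective (hπ n)
        (hexact (n + 1)) Subtype.val_injective (hπ (n + 1)) (transitionKer π x hxπ j n)
        (x j (n + 1)) (x j n) rfl (hxπ j n) e
    · obtain ⟨z, hz⟩ := exists_extConnecting_eq A i (hexact n) Subtype.val_injective (hπ n)
        e.1 e.2
      exact ⟨z, Subtype.ext hz⟩

lemma isLoweringArtinian_extTransitionCoker (hπ : ∀ n, Function.Surjective (π n))
    {s : Finset ι}
    (h : IsLoweringArtinian
      (E := fun n ↦ Abelian.Ext (ModuleCat.of R (LinearMap.ker (π n))) A i)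
      (fun j n ↦ extPrecomp A i (transitionKer π x hxπ j n)) s) :
    IsLoweringArtinian
      (E := fun n ↦ Abelian.Ext (ModuleCat.of R (Q (n + 1))) A i ⧸
        LinearMap.range (extPrecomp A i (π n)))
      (extTransitionCoker A i π x hxπ) s := by
  have hexact (n) : Function.Exact (LinearMap.ker (π n)).subtype (π n) :=
    LinearMap.exact_subtype_ker_map _
  have hle (n) : LinearMap.range (extPrecomp A i (π n)) ≤
      LinearMap.ker (extPrecomp A i (LinearMap.ker (π n)).subtype) := by
    rintro _ ⟨e, rfl⟩
    rw [LinearMap.mem_ker, extPrecomp_comp, (hexact n).linearMap_comp_eq_zero, extPrecomp_zero]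
  refine .of_exact
    (isLoweringArtinian_of_subsingleton (R := R) (E := fun _ ↦ PUnit.{1}) (fun _ _ ↦ 0) _)
    h (fun _ ↦ 0)
    (fun n ↦ (LinearMap.range (extPrecomp A i (π n))).liftQ
      (extPrecomp A i (LinearMap.ker (π n)).subtype) (hle n))
    (fun _ _ _ _ ↦ by simp) (fun j _ n e ↦ ?_) fun n e he ↦ ⟨0, ?_⟩
  · obtain ⟨e, rfl⟩ := Submodule.mkQ_surjective _ e
    exact extPrecomp_congr_comp A i (f := (LinearMap.ker (π n)).subtype) (g := x j (n + 1))
      (f' := transitionKer π x hxπ j n) (g' := (LinearMap.ker (π (n + 1))).subtype) rfl e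
  · obtain ⟨e, rfl⟩ := Submodule.mkQ_surjective _ e
    obtain ⟨z, hz⟩ := exists_extPrecomp_eq A i (hexact n) Subtype.val_injective (hπ n) e he
    have hmem : e ∈ LinearMap.range (extPrecomp A i (π n)) := ⟨z, hz⟩
    exact ((Submodule.Quotient.mk_eq_zero _).2 hmem).symm

/-- If the kernels of the transition maps of an inverse system form a Noetherian graded module,
then the lengths of its `Ext` modules into an Artinian module are eventually polynomial. -/
theorem isEventuallyPolynomial_length_ext [IsNoetherianRing R] [IsArtinian R A]
    [∀ n, IsNoetherian R (Q n)] (hπ : ∀ n, Function.Surjective (π n)) (s : Finset ι)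
    (hcomm : ∀ j k n z, x j (n + 1) (x k n z) = x k (n + 1) (x j n z))
    (h : IsRaisingNoetherian (transitionKer π x hxπ) s) (n₀ : ℕ)
    (hfin : ∀ n, n₀ ≤ n → IsFiniteLength R (Abelian.Ext (ModuleCat.of R (Q n)) A i)) :
    IsEventuallyPolynomial
      fun n ↦ Module.length R (Abelian.Ext (ModuleCat.of R (Q n)) A i) := by
  have hExt := h.isLoweringArtinian_ext A (M := fun n ↦ LinearMap.ker (π n)) _ s
    fun j k n z ↦ Subtype.ext (hcomm j k (n + 1) z)
  have hK := (isLoweringArtinian_extTransitionKer A i hxπ hπ hExt).isEventuallyPolynomial_length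
    _ s (fun j k n e ↦ Subtype.ext
      (extPrecomp_congr_comp A i (LinearMap.ext fun z ↦ hcomm k j n z) e.1)) n₀
    fun n hn ↦ (hfin n hn).of_injective
      (f := (LinearMap.ker (extPrecomp A i (π n))).subtype) Subtype.val_injective
  have hC := (isLoweringArtinian_extTransitionCoker A i hxπ hπ
    (hExt i)).isEventuallyPolynomial_length _ s (fun j k n e ↦ by
      obtain ⟨e, rfl⟩ := Submodule.mkQ_surjective _ e
      exact congrArg (Submodule.mkQ _)
        (extPrecomp_congr_comp A i (LinearMap.ext fun z ↦ hcomm k j (n + 1) z) e)) n₀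
    fun n hn ↦ (hfin (n + 1) (by omega)).of_surjective (Submodule.mkQ_surjective _)
  exact .of_add_eq
    (h := fun n ↦ Module.length R (Abelian.Ext (ModuleCat.of R (Q n)) A i)) hC hK
    n₀ (fun n hn ↦ Module.length_ne_top_iff.2 (hfin n hn))
    fun n _ ↦ ((extPrecomp A i (π n)).length_add_length_coker).symm

end InverseSystems

section AdicQuotients

variable {R : Type*} [CommRing R] (I : Ideal R) (N : Type*) [AddCommGroup N] [Module R N]

/-- The projection `N / I ^ (n + 1) N → N / I ^ n N`. -/
def adicProj (n : ℕ) :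
    (N ⧸ (I ^ (n + 1) • ⊤ : Submodule R N)) →ₗ[R] N ⧸ (I ^ n • ⊤ : Submodule R N) :=
  Submodule.factor (Submodule.smul_mono_left (Ideal.pow_le_pow_right n.le_succ))

/-- Multiplication by an element of `I`, as a map `N / I ^ n N → N / I ^ (n + 1) N`. -/
def adicMul (a : I) (n : ℕ) :
    (N ⧸ (I ^ n • ⊤ : Submodule R N)) →ₗ[R] N ⧸ (I ^ (n + 1) • ⊤ : Submodule R N) :=
  Submodule.mapQ _ _ (LinearMap.lsmul R N a) fun z hz ↦ by
    rw [pow_succ', mul_smul]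
    exact Submodule.smul_mem_smul a.2 hz

lemma adicProj_comp_adicMul (a : I) (n : ℕ) :
    adicProj I N (n + 1) ∘ₗ adicMul I N a (n + 1) = adicMul I N a n ∘ₗ adicProj I N n := by
  ext z
  rfl

lemma adicMul_adicMul (a b : I) (n : ℕ) (z : N ⧸ (I ^ n • ⊤ : Submodule R N)) :
    adicMul I N a (n + 1) (adicMul I N b n z) = adicMul I N b (n + 1) (adicMul I N a n z) := by
  obtain ⟨z, rfl⟩ := Submodule.mkQ_surjective _ z
  exact congrArg (Submodule.mkQ _) (smul_comm (a : R) (b : R) z)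

lemma adicProj_surjective (n : ℕ) : Function.Surjective (adicProj I N n) :=
  Submodule.factor_surjective (Submodule.smul_mono_left (Ideal.pow_le_pow_right n.le_succ))

/-- Multiplication by an element of `I`, as a map
`I ^ n N / I ^ (n + 1) N → I ^ (n + 1) N / I ^ (n + 2) N`. -/
abbrev adicMulKer (a : I) (n : ℕ) :
    LinearMap.ker (adicProj I N n) →ₗ[R] LinearMap.ker (adicProj I N (n + 1)) :=
  transitionKer (Q := fun n ↦ N ⧸ (I ^ n • ⊤ : Submodule R N)) (adicProj I N) (adicMul I N)
    (adicProj_comp_adicMul I N) a n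

/-- The associated graded module of `N` is generated in degree zero. -/
lemma iSup_range_adicMulKer (s : Finset I)
    (hs : Submodule.span R (s : Set I) = ⊤) (n : ℕ) :
    ⨆ a ∈ s, LinearMap.range
      (adicMulKer I N a n) = ⊤ := by
  set W := ⨆ a ∈ s, LinearMap.range
    (adicMulKer I N a n)
  have hpow : (I ^ (n + 1) • ⊤ : Submodule R N) = I • (I ^ n • ⊤ : Submodule R N) := by
    rw [pow_succ', mul_smul]
  have key : (I ^ (n + 1) • ⊤ : Submodule R N) ≤
      (W.map (Submodule.subtype _)).comap (I ^ (n + 2) • ⊤ : Submodule R N).mkQ := by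
    refine hpow.trans_le (Submodule.smul_le.2 fun r hr z hz ↦ ?_)
    have hle : Submodule.span R (s : Set I) ≤
        ((W.map (Submodule.subtype _)).comap (I ^ (n + 2) • ⊤ : Submodule R N).mkQ).comap
          (LinearMap.toSpanSingleton R N z ∘ₗ Submodule.subtype I) := by
      refine Submodule.span_le.2 fun a ha ↦ ?_
      have hz' : (I ^ (n + 1) • ⊤ : Submodule R N).mkQ z ∈ LinearMap.ker (adicProj I N n) :=
        (Submodule.Quotient.mk_eq_zero _).2 hz
      exact ⟨adicMulKer I N a n ⟨_, hz'⟩,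
        Submodule.mem_iSup_of_mem a (Submodule.mem_iSup_of_mem ha ⟨_, rfl⟩), rfl⟩
    exact hle (hs ▸ Submodule.mem_top : (⟨r, hr⟩ : I) ∈ Submodule.span R (s : Set I))
  rw [eq_top_iff]
  rintro ⟨z, hz⟩ -
  obtain ⟨z, rfl⟩ := Submodule.mkQ_surjective _ z
  obtain ⟨w, hw, hwz⟩ := key ((Submodule.Quotient.mk_eq_zero _).1 hz)
  have : w = ⟨_, hz⟩ := Subtype.ext hwz
  exact this ▸ hw

end AdicQuotients

/-- Corollary 6(b). Let `R` be a commutative Noetherian ring, `I` an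
ideal, `N` a finitely generated `R`-module, and `A` an Artinian `R`-module.  Fix `i ≥ 0`
and assume `Ext_R^i(N/IⁿN, A)` has finite length for all `n ≫ 0`.  Then there is a
polynomial `p ∈ ℚ[X]` with `λ(Ext_R^i(N/IⁿN, A)) = p(n)` for all `n ≫ 0`. -/
theorem stmt_13 {R : Type u} [CommRing R] [IsNoetherianRing R] (I : Ideal R)
    (A N : Type u) [AddCommGroup A] [Module R A] [IsArtinian R A]
    [AddCommGroup N] [Module R N] [Module.Finite R N] (i : ℕ)
    (hfin : ∃ N₀ : ℕ, ∀ n ≥ N₀,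
      IsFiniteLength R (extModule R i (N ⧸ (I ^ n • ⊤ : Submodule R N)) A)) :
    ∃ (p : Polynomial ℚ) (N₀ : ℕ), ∀ n ≥ N₀, ∃ ℓ : ℕ,
      moduleLength R (extModule R i (N ⧸ (I ^ n • ⊤ : Submodule R N)) A) = ℓ ∧
      (ℓ : ℚ) = p.eval (n : ℚ) := by
  obtain ⟨s, hs⟩ := (inferInstance : Module.Finite R I).fg_top
  obtain ⟨N₀, hN₀⟩ := hfin
  have hgr := IsRaisingNoetherian.of_generated
    (M := fun n ↦ LinearMap.ker (adicProj I N n)) (adicMulKer I N) s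
    (fun j k n z ↦ Subtype.ext (adicMul_adicMul I N j k (n + 1) z)) 0
    fun n _ ↦ iSup_range_adicMulKer I N s hs n
  have e (n : ℕ) : extModule R i (N ⧸ (I ^ n • ⊤ : Submodule R N)) A ≃ₗ[R]
      Abelian.Ext (ModuleCat.of R (N ⧸ (I ^ n • ⊤ : Submodule R N))) (ModuleCat.of R A) i :=
    (nonempty_ext_linearEquiv_abelianExt _ _ i).some
  obtain ⟨p, N₁, hp⟩ := isEventuallyPolynomial_length_ext
    (Q := fun n ↦ N ⧸ (I ^ n • ⊤ : Submodule R N)) (ModuleCat.of R A) i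
    (adicProj_comp_adicMul I N) (adicProj_surjective I N) s (adicMul_adicMul I N) hgr N₀
    fun n hn ↦ (hN₀ n hn).of_surjective (f := (e n).toLinearMap) (e n).surjective
  refine ⟨p, N₁, fun n hn ↦ ?_⟩
  obtain ⟨l, hl, hl'⟩ := hp n hn
  refine ⟨l, ?_, hl'⟩
  rw [moduleLength, ← Module.coe_length, (e n).length_eq]
  exact congrArg _ hl
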